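/- Let δ be a nonzero derivation on a field K with field of constants F. Then R = K[t;δ] has finite rank over its center if and only if K/F is a finite field extension; and if K/F is finite, then every f ∈ R is bounded, and in particular every irreducible f ∈ R of degree m ≥ 2 yields a Petit algebra S_f which is a division algebra. -/

import Mathlib

open scoped TensorProduct

/-! ## A framework for differential polynomial rings `K[t;δ]` and Petit algebras `S_f`. -/

/-- A derivation on a field `K`: an additive map satisfying the Leibniz rule. -/
structure Der (K : Type) [Field K] where
  toFun : K → K
  map_add' : ∀ a b : K, toFun (a + b) = toFun a + toFun b
  leibniz' : ∀ a b : K, toFun (a * b) = a * toFun b + toFun a * b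

/-- `F` (given as a subfield of `K` via `algebraMap F K`) is precisely the field of
constants `Const(δ) = {a ∈ K | δ(a) = 0}` of the derivation `δ`. -/
def Der.HasConstants {K : Type} [Field K] (δ : Der K) (F : Type) [Field F]
    [Algebra F K] : Prop :=
  ∀ a : K, δ.toFun a = 0 ↔ ∃ c : F, algebraMap F K c = a

/-- The map `V_p(b) = b^p + δ^{p-1}(b)`. -/
def Der.Vp {K : Type} [Field K] (δ : Der K) (p : ℕ) (b : K) : K :=
  b ^ p + δ.toFun^[p - 1] b

/-- The `e`-fold iterate `V_{p^e}` of `V_p`. -/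
def Der.VpIter {K : Type} [Field K] (δ : Der K) (p e : ℕ) : K → K :=
  (δ.Vp p)^[e]

/-- A realization of the differential polynomial ring `R = K[t;δ]`: a ring `R`
together with an embedding `i : K → R` and an element `t` satisfying the
twist relation `t·a = a·t + δ(a)`, such that every element of `R` is *uniquely*
a left `K`-linear combination of the powers `t^n` (witnessed by the coefficient
function `coeff`), and such that `R` admits a right division algorithm. -/
structure DiffPolyRing (K : Type) [Field K] (δ : Der K) (R : Type) [Ring R] where
  i : K →+* R
  t : R
  coeff : R → (ℕ →₀ K)
  t_mul : ∀ a : K, t * i a = i a * t + i (δ.toFun a)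
  repr' : ∀ x : R, x = (coeff x).sum fun n a => i a * t ^ n
  coeff_unique : ∀ (x : R) (c : ℕ →₀ K), x = (c.sum fun n a => i a * t ^ n) → c = coeff x
  rightDiv : ∀ f x : R, f ≠ 0 → ∃! r : R,
    (∃ q : R, x = q * f + r) ∧ (coeff r).support.max < (coeff f).support.max

namespace DiffPolyRing

variable {K : Type} [Field K] {δ : Der K} {R : Type} [Ring R]

/-- The degree of a differential polynomial, with `deg 0 = ⊥`. -/
def deg (D : DiffPolyRing K δ R) (x : R) : WithBot ℕ := (D.coeff x).support.max

lemma coeff_zero (D : DiffPolyRing K δ R) : D.coeff 0 = 0 :=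
  (D.coeff_unique 0 0 (by simp)).symm

lemma deg_zero (D : DiffPolyRing K δ R) : D.deg 0 = ⊥ := by
  simp [deg, D.coeff_zero]

lemma coeff_add (D : DiffPolyRing K δ R) (x y : R) :
    D.coeff (x + y) = D.coeff x + D.coeff y := by
  refine (D.coeff_unique _ _ ?_).symm
  rw [Finsupp.sum_add_index' (by simp) (by intro n a b; rw [map_add, add_mul])]
  conv_lhs => rw [D.repr' x, D.repr' y]

lemma coeff_neg (D : DiffPolyRing K δ R) (x : R) : D.coeff (-x) = -D.coeff x := by
  have h := D.coeff_add (-x) x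
  rw [neg_add_cancel, D.coeff_zero] at h
  exact eq_neg_of_add_eq_zero_left h.symm

lemma deg_neg (D : DiffPolyRing K δ R) (x : R) : D.deg (-x) = D.deg x := by
  simp [deg, D.coeff_neg]

lemma deg_add_lt (D : DiffPolyRing K δ R) {x y : R} {n : WithBot ℕ}
    (hx : D.deg x < n) (hy : D.deg y < n) : D.deg (x + y) < n := by
  have hsub : (D.coeff (x + y)).support ⊆ (D.coeff x).support ∪ (D.coeff y).support := by
    rw [D.coeff_add]; exact Finsupp.support_add
  calc D.deg (x + y) ≤ ((D.coeff x).support ∪ (D.coeff y).support).max :=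
        Finset.max_mono hsub
    _ = max (D.deg x) (D.deg y) := Finset.max_union
    _ < n := max_lt hx hy

lemma coeff_smul (D : DiffPolyRing K δ R) (c : K) (x : R) :
    D.coeff (D.i c * x) = c • D.coeff x := by
  refine (D.coeff_unique _ _ ?_).symm
  rw [Finsupp.sum_smul_index (by simp)]
  conv_lhs => rw [D.repr' x, Finsupp.mul_sum]
  exact Finsupp.sum_congr fun n _ => by rw [← mul_assoc, ← map_mul]

lemma deg_i_mul_lt (D : DiffPolyRing K δ R) (c : K) {x : R} {n : WithBot ℕ}
    (hx : D.deg x < n) : D.deg (D.i c * x) < n := by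
  have hsub : (D.coeff (D.i c * x)).support ⊆ (D.coeff x).support := by
    rw [D.coeff_smul]; exact Finsupp.support_smul
  exact lt_of_le_of_lt (Finset.max_mono hsub) hx

/-- The additive subgroup of `R` consisting of the differential polynomials of
degree `< m`; this is the underlying set of the Petit algebra `S_f` for `deg f = m`. -/
def res (D : DiffPolyRing K δ R) (m : ℕ) : AddSubgroup R where
  carrier := {x | D.deg x < (m : WithBot ℕ)}
  add_mem' hx hy := D.deg_add_lt hx hy
  zero_mem' := by
    show D.deg 0 < (m : WithBot ℕ)
    rw [D.deg_zero]
    exact bot_lt_iff_ne_bot.2 (by simp)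
  neg_mem' {x} hx := by
    show D.deg (-x) < (m : WithBot ℕ)
    rw [D.deg_neg]; exact hx

/-- The underlying set `{g ∈ K[t;δ] | deg g < m}` of the Petit algebra `S_f`
(for `f` of degree `m`), viewed as a subset of `R = K[t;δ]`. -/
def SfSet (D : DiffPolyRing K δ R) (m : ℕ) : Set R := {x | D.deg x < (m : WithBot ℕ)}

/-- The underlying `F`-vector space of the Petit algebra `S_f`, for `f` of degree `m`. -/
abbrev Rlt (D : DiffPolyRing K δ R) (m : ℕ) : Type := ↥(D.res m)

instance instSMul {F : Type} [Field F] [Algebra F K] (D : DiffPolyRing K δ R) (m : ℕ) :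
    SMul F (D.Rlt m) :=
  ⟨fun c x => ⟨D.i (algebraMap F K c) * (x : R), D.deg_i_mul_lt _ x.2⟩⟩

lemma smul_coe {F : Type} [Field F] [Algebra F K] (D : DiffPolyRing K δ R) (m : ℕ)
    (c : F) (x : D.Rlt m) : ((c • x : D.Rlt m) : R) = D.i (algebraMap F K c) * (x : R) := rfl

/-- The `F`-vector space structure of the Petit algebra (where `F ⊆ K` is the field
of constants): `c • x = i(c)·x`. -/
instance instModule {F : Type} [Field F] [Algebra F K] (D : DiffPolyRing K δ R) (m : ℕ) :
    Module F (D.Rlt m) where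
  one_smul x := Subtype.ext <| by rw [smul_coe]; simp
  mul_smul a b x := Subtype.ext <| by rw [smul_coe, smul_coe, smul_coe]; simp [mul_assoc]
  smul_zero a := Subtype.ext <| by rw [smul_coe]; simp
  smul_add a x y := Subtype.ext <| by
    rw [smul_coe]
    push_cast
    rw [smul_coe, smul_coe, mul_add]
  add_smul a b x := Subtype.ext <| by
    push_cast
    rw [smul_coe, smul_coe, smul_coe]
    simp [add_mul]
  zero_smul x := Subtype.ext <| by rw [smul_coe]; simp

open Classical in
/-- The remainder `mod_r f` of right division by `f`. -/
noncomputable def modr (D : DiffPolyRing K δ R) (f x : R) : R :=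
  if h : ∃! r : R, (∃ q : R, x = q * f + r) ∧
      (D.coeff r).support.max < (D.coeff f).support.max then h.choose else 0

/-- The multiplication of the Petit algebra `S_f`: `g ∘ h = g·h mod_r f`. -/
noncomputable def pmul (D : DiffPolyRing K δ R) (f x y : R) : R := D.modr f (x * y)

/-- The left nucleus of the Petit algebra `S_f`, as a subset of `R`. -/
def nucl (D : DiffPolyRing K δ R) (f : R) (m : ℕ) : Set R :=
  {x ∈ D.SfSet m | ∀ y ∈ D.SfSet m, ∀ z ∈ D.SfSet m,
    D.pmul f (D.pmul f x y) z = D.pmul f x (D.pmul f y z)}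

/-- The middle nucleus of the Petit algebra `S_f`, as a subset of `R`. -/
def nucm (D : DiffPolyRing K δ R) (f : R) (m : ℕ) : Set R :=
  {x ∈ D.SfSet m | ∀ y ∈ D.SfSet m, ∀ z ∈ D.SfSet m,
    D.pmul f (D.pmul f y x) z = D.pmul f y (D.pmul f x z)}

/-- The right nucleus of the Petit algebra `S_f`, as a subset of `R`. -/
def nucr (D : DiffPolyRing K δ R) (f : R) (m : ℕ) : Set R :=
  {x ∈ D.SfSet m | ∀ y ∈ D.SfSet m, ∀ z ∈ D.SfSet m,
    D.pmul f (D.pmul f y z) x = D.pmul f y (D.pmul f z x)}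

/-- The nucleus of the Petit algebra `S_f`, as a subset of `R`. -/
def nuc (D : DiffPolyRing K δ R) (f : R) (m : ℕ) : Set R :=
  D.nucl f m ∩ D.nucm f m ∩ D.nucr f m

/-- `f` is irreducible in `K[t;δ]`: it is not a unit and admits no factorization
into two factors of strictly smaller degree. -/
def Irred (D : DiffPolyRing K δ R) (f : R) : Prop :=
  ¬IsUnit f ∧ ¬∃ g h : R, f = g * h ∧ D.deg g < D.deg f ∧ D.deg h < D.deg f

/-- The Petit algebra `S_f` is a division algebra: it is nonzero, and all left and
right multiplications by nonzero elements are bijective. -/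
def IsDivisionPetit (D : DiffPolyRing K δ R) (f : R) (m : ℕ) : Prop :=
  (∃ x ∈ D.SfSet m, x ≠ 0) ∧ ∀ a ∈ D.SfSet m, a ≠ 0 →
    Set.BijOn (fun x => D.pmul f a x) (D.SfSet m) (D.SfSet m) ∧
    Set.BijOn (fun x => D.pmul f x a) (D.SfSet m) (D.SfSet m)

/-- The unital `F`-algebra `B` realizes the right nucleus of the Petit algebra `S_f`:
there is a bijection `B ≃ Nuc_r(S_f)` preserving addition, multiplication and the
`F`-algebra structure. -/
def RightNucPresents (F : Type) [Field F] [Algebra F K] (D : DiffPolyRing K δ R)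
    (f : R) (m : ℕ) (B : Type) [Ring B] [Algebra F B] : Prop :=
  ∃ φ : B ≃ (D.nucr f m),
    (∀ x y : B, ((φ (x + y) : R)) = (φ x : R) + (φ y : R)) ∧
    (∀ x y : B, ((φ (x * y) : R)) = D.pmul f (φ x : R) (φ y : R)) ∧
    (∀ c : F, ((φ (algebraMap F B c) : R)) = D.i (algebraMap F K c))

/-- A subset `S` of an `F`-vector space has dimension `d`: it contains `d` linearly
independent vectors whose span contains `S`. -/
def SetDim (F : Type) [Field F] {M : Type} [AddCommGroup M] [Module F M]
    (S : Set M) (d : ℕ) : Prop :=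
  ∃ s : Finset M, ↑s ⊆ S ∧ s.card = d ∧
    LinearIndependent F (fun x : (s : Set M) => (x : M)) ∧
    S ⊆ (Submodule.span F (s : Set M) : Set M)

/-- `f ∈ K[t;δ]` of degree `m` is an `A`-polynomial (over the field of constants `F`),
via Amitsur's characterization: the right nucleus of `S_f` has dimension `m²` over `F`. -/
def IsAPoly (F : Type) [Field F] [Algebra F K] (D : DiffPolyRing K δ R)
    (f : R) (m : ℕ) : Prop :=
  SetDim F {x : D.Rlt m | (x : R) ∈ D.nucr f m} (m ^ 2)

/-- `f ∈ R = K[t;δ]` is bounded: there is `f* ≠ 0` such that `Rf* = f*R` is the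
largest two-sided ideal of `R` contained in `Rf`. -/
def IsBounded (D : DiffPolyRing K δ R) (f : R) : Prop :=
  ∃ fs : R, fs ≠ 0 ∧
    {x : R | ∃ r, x = r * fs} = {x : R | ∃ r, x = fs * r} ∧
    (∀ x : R, (∃ r, x = r * fs) → ∃ r, x = r * f) ∧
    ∀ J : Set R, (0 : R) ∈ J → (∀ a ∈ J, ∀ b ∈ J, a + b ∈ J) →
      (∀ r : R, ∀ a ∈ J, r * a ∈ J ∧ a * r ∈ J) →
      (∀ x ∈ J, ∃ r, x = r * f) → ∀ x ∈ J, ∃ r, x = r * fs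

/-- `S_f` is a free right module of rank `n` over its right nucleus. -/
def FreeRankOverNucr (D : DiffPolyRing K δ R) (f : R) (m n : ℕ) : Prop :=
  ∃ b : Fin n → R, (∀ j, b j ∈ D.SfSet m) ∧
    ∀ x ∈ D.SfSet m, ∃! c : Fin n → (D.nucr f m),
      x = ∑ j, D.pmul f (b j) ((c j : R))

/-- The Petit algebra `S_f` is unital with unit `1 ∈ K[t;δ]`. -/
def PetitUnital (D : DiffPolyRing K δ R) (f : R) (m : ℕ) : Prop :=
  (1 : R) ∈ D.SfSet m ∧ ∀ x ∈ D.SfSet m, D.pmul f 1 x = x ∧ D.pmul f x 1 = x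

end DiffPolyRing

namespace Der

variable {K : Type} [Field K] (δ : Der K)

lemma map_zero : δ.toFun 0 = 0 := by
  simpa using δ.map_add' 0 0

lemma map_one : δ.toFun 1 = 0 := by
  simpa using δ.leibniz' 1 1

end Der

namespace DiffPolyRing

variable {K : Type} [Field K] {δ : Der K} {R : Type} [Ring R]

section Coefficients

variable (D : DiffPolyRing K δ R)

lemma induction_on {P : R → Prop} (x : R) (zero : P 0) (add : ∀ x y, P x → P y → P (x + y))
    (monomial : ∀ a n, P (D.i a * D.t ^ n)) : P x := by
  rw [D.repr' x]
  exact Finset.sum_induction _ P add zero fun n _ => monomial _ n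

lemma coeff_injective : Function.Injective D.coeff := fun x y h => by
  rw [D.repr' x, D.repr' y, h]

lemma coeff_sub (x y : R) : D.coeff (x - y) = D.coeff x - D.coeff y := by
  rw [sub_eq_add_neg, D.coeff_add, D.coeff_neg, sub_eq_add_neg]

lemma coeff_monomial (a : K) (n : ℕ) : D.coeff (D.i a * D.t ^ n) = Finsupp.single n a :=
  (D.coeff_unique _ _ (by simp)).symm

lemma coeff_i (a : K) : D.coeff (D.i a) = Finsupp.single 0 a := by
  simpa using D.coeff_monomial a 0

lemma coeff_mul_t_succ (x : R) (n : ℕ) : D.coeff (x * D.t) (n + 1) = D.coeff x n := by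
  induction x using D.induction_on with
  | zero => simp [D.coeff_zero]
  | add x y hx hy => simp [add_mul, D.coeff_add, hx, hy]
  | monomial a k =>
    rw [mul_assoc, ← pow_succ, D.coeff_monomial, D.coeff_monomial]
    simp [Finsupp.single_apply]

lemma coeff_commutator_t (x : R) (n : ℕ) :
    D.coeff (D.t * x - x * D.t) n = δ.toFun (D.coeff x n) := by
  induction x using D.induction_on with
  | zero => simp [D.coeff_zero, δ.map_zero]
  | add x y hx hy =>
    rw [mul_add, add_mul, add_sub_add_comm, D.coeff_add, Finsupp.add_apply, hx, hy, D.coeff_add,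
      Finsupp.add_apply, δ.map_add']
  | monomial a k =>
    have h : D.t * (D.i a * D.t ^ k) - D.i a * D.t ^ k * D.t = D.i (δ.toFun a) * D.t ^ k := by
      rw [← mul_assoc, D.t_mul, add_mul, mul_assoc, mul_assoc, ← pow_succ, ← pow_succ']
      abel
    rw [h, D.coeff_monomial, D.coeff_monomial]
    by_cases hk : k = n
    · simp [hk]
    · simp [hk, δ.map_zero]

lemma coeff_t_mul_succ (x : R) (n : ℕ) :
    D.coeff (D.t * x) (n + 1) = D.coeff x n + δ.toFun (D.coeff x (n + 1)) := by
  rw [← D.coeff_commutator_t, D.coeff_sub, Finsupp.sub_apply, D.coeff_mul_t_succ]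
  ring

lemma deg_lt_iff {x : R} {n : ℕ} : D.deg x < n ↔ ∀ j, n ≤ j → D.coeff x j = 0 := by
  rw [deg, Finset.max_eq_sup_withBot]
  refine (Finset.sup_lt_iff (WithBot.bot_lt_coe n)).trans ?_
  constructor
  · intro h j hj
    by_contra hx
    have := WithBot.coe_lt_coe.1 (h j (by simpa using hx))
    omega
  · intro h j hj
    refine WithBot.coe_lt_coe.2 (lt_of_not_ge fun hn => ?_)
    simp [h j hn] at hj

/-- `x` has degree at most `n`, and its coefficient of `t ^ n` is `a`. -/
def HasTop (x : R) (n : ℕ) (a : K) : Prop :=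
  D.coeff x n = a ∧ ∀ j, n < j → D.coeff x j = 0

variable {D}

lemma HasTop.deg_lt_succ {x : R} {n : ℕ} {a : K} (h : D.HasTop x n a) :
    D.deg x < (n + 1 : ℕ) :=
  D.deg_lt_iff.2 fun j hj => h.2 j hj

lemma HasTop.deg_lt {x : R} {n : ℕ} (h : D.HasTop x n 0) : D.deg x < n :=
  D.deg_lt_iff.2 fun j hj => by
    rcases hj.eq_or_lt with rfl | hj
    exacts [h.1, h.2 j hj]

lemma HasTop.deg_eq {x : R} {n : ℕ} {a : K} (h : D.HasTop x n a) (ha : a ≠ 0) :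
    D.deg x = n := by
  refine le_antisymm ?_ (not_lt.1 fun hlt => ha ?_)
  · exact Finset.max_le fun j hj => WithBot.coe_le_coe.2 <| not_lt.1 fun hn => by
      simp [h.2 j hn] at hj
  · rw [← h.1, D.deg_lt_iff.1 hlt n le_rfl]

variable (D) in
lemma exists_hasTop {x : R} (hx : x ≠ 0) : ∃ (n : ℕ) (a : K), a ≠ 0 ∧ D.HasTop x n a := by
  have hs : (D.coeff x).support.Nonempty := by
    rw [Finsupp.support_nonempty_iff]
    exact fun h => hx (D.coeff_injective (h.trans D.coeff_zero.symm))
  refine ⟨_, _, Finsupp.mem_support_iff.1 (Finset.max'_mem _ hs), rfl, fun j hj => ?_⟩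
  by_contra hne
  exact hj.not_ge (Finset.le_max' _ _ (Finsupp.mem_support_iff.2 hne))

lemma hasTop_of_deg_eq {x : R} {n : ℕ} (h : D.deg x = n) : ∃ a : K, a ≠ 0 ∧ D.HasTop x n a := by
  have hx : x ≠ 0 := by
    rintro rfl
    rw [D.deg_zero] at h
    exact WithBot.bot_ne_coe h
  obtain ⟨k, a, ha, hk⟩ := D.exists_hasTop hx
  obtain rfl : k = n := WithBot.coe_injective ((hk.deg_eq ha).symm.trans h)
  exact ⟨a, ha, hk⟩

lemma HasTop.t_pow_mul {y : R} {k : ℕ} {b : K} (h : D.HasTop y k b) (j : ℕ) :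
    D.HasTop (D.t ^ j * y) (j + k) b := by
  induction j with
  | zero => simpa using h
  | succ j ih =>
    rw [pow_succ', mul_assoc, Nat.succ_add]
    refine ⟨?_, fun l hl => ?_⟩
    · rw [D.coeff_t_mul_succ, ih.1, ih.2 _ (Nat.lt_succ_self _), δ.map_zero, add_zero]
    · obtain ⟨l, rfl⟩ : ∃ l', l = l' + 1 := ⟨l - 1, by omega⟩
      rw [D.coeff_t_mul_succ, ih.2 l (by omega), ih.2 (l + 1) (by omega), δ.map_zero, add_zero]

variable (D) in
lemma coeff_sum {ι : Type*} (s : Finset ι) (g : ι → R) :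
    D.coeff (∑ j ∈ s, g j) = ∑ j ∈ s, D.coeff (g j) :=
  map_sum (AddMonoidHom.mk' D.coeff D.coeff_add) g s

variable (D) in
lemma coeff_mul (x y : R) (n : ℕ) :
    D.coeff (x * y) n = ∑ j ∈ (D.coeff x).support, D.coeff x j * D.coeff (D.t ^ j * y) n := by
  conv_lhs => rw [D.repr' x, Finsupp.sum, Finset.sum_mul, D.coeff_sum]
  simp [Finsupp.finsetSum_apply, mul_assoc, D.coeff_smul]

lemma HasTop.mul {x y : R} {n k : ℕ} {a b : K} (hx : D.HasTop x n a) (hy : D.HasTop y k b) :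
    D.HasTop (x * y) (n + k) (a * b) := by
  have hle : ∀ j ∈ (D.coeff x).support, j ≤ n := fun j hj => not_lt.1 fun hn => by
    simp [hx.2 j hn] at hj
  refine ⟨?_, fun l hl => ?_⟩
  · rw [D.coeff_mul, Finset.sum_eq_single n, hx.1, (hy.t_pow_mul n).1]
    · intro j hj hjn
      rw [(hy.t_pow_mul j).2 _ (by have := hle j hj; omega), mul_zero]
    · intro hn
      rw [Finsupp.notMem_support_iff.1 hn, zero_mul]
  · rw [D.coeff_mul]
    refine Finset.sum_eq_zero fun j hj => ?_
    rw [(hy.t_pow_mul j).2 l (by have := hle j hj; omega), mul_zero]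

lemma HasTop.sub {x y : R} {n : ℕ} {a b : K} (hx : D.HasTop x n a) (hy : D.HasTop y n b) :
    D.HasTop (x - y) n (a - b) :=
  ⟨by simp [D.coeff_sub, hx.1, hy.1], fun j hj => by simp [D.coeff_sub, hx.2 j hj, hy.2 j hj]⟩

variable (D) in
lemma hasTop_i (a : K) : D.HasTop (D.i a) 0 a := by
  rw [HasTop, D.coeff_i]
  exact ⟨by simp, fun j hj => Finsupp.single_eq_of_ne hj.ne'⟩

lemma eq_zero_of_mul_deg_lt {q f : R} (hf : f ≠ 0) (h : D.deg (q * f) < D.deg f) : q = 0 := by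
  by_contra hq
  obtain ⟨n, a, ha, hn⟩ := D.exists_hasTop hq
  obtain ⟨k, b, hb, hk⟩ := D.exists_hasTop hf
  rw [(hn.mul hk).deg_eq (mul_ne_zero ha hb), hk.deg_eq hb] at h
  exact absurd (WithBot.coe_lt_coe.1 h) (Nat.le_add_left k n).not_gt

end Coefficients

section Ideals

variable (D : DiffPolyRing K δ R)

lemma nontrivial (D : DiffPolyRing K δ R) : Nontrivial R := by
  refine ⟨1, 0, fun h => ?_⟩
  have := (D.hasTop_i 1).1
  simp [h, D.coeff_zero] at this

lemma exists_monic_generator {I : Ideal R} (hI : I ≠ ⊥) :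
    ∃ (z : R) (n : ℕ), z ∈ I ∧ z ≠ 0 ∧ D.HasTop z n 1 ∧ (∀ x ∈ I, D.deg x < n → x = 0) ∧
      ∀ x ∈ I, ∃ q, x = q * z := by
  classical
  have hex : ∃ (n : ℕ) (x : R), x ∈ I ∧ ∃ a : K, a ≠ 0 ∧ D.HasTop x n a := by
    obtain ⟨x, hxI, hx⟩ := Submodule.exists_mem_ne_zero_of_ne_bot hI
    obtain ⟨n, a, h⟩ := D.exists_hasTop hx
    exact ⟨n, x, hxI, a, h⟩
  obtain ⟨x, hxI, a, ha, hx⟩ := Nat.find_spec hex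
  have hz : D.HasTop (D.i a⁻¹ * x) (Nat.find hex) 1 := by
    simpa [ha] using (D.hasTop_i a⁻¹).mul hx
  have hz0 : D.i a⁻¹ * x ≠ 0 := by
    intro h
    have := hz.1
    simp [h, D.coeff_zero] at this
  have hzI : D.i a⁻¹ * x ∈ I := I.mul_mem_left _ hxI
  have hmin : ∀ y ∈ I, D.deg y < Nat.find hex → y = 0 := by
    intro y hyI hy
    by_contra hy0
    obtain ⟨k, b, hb, hk⟩ := D.exists_hasTop hy0
    rw [hk.deg_eq hb] at hy
    exact Nat.find_min hex (WithBot.coe_lt_coe.1 hy) ⟨y, hyI, b, hb, hk⟩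
  refine ⟨_, _, hzI, hz0, hz, hmin, fun y hy => ?_⟩
  obtain ⟨r, ⟨⟨q, hq⟩, hr⟩, -⟩ := D.rightDiv _ y hz0
  have hrI : r ∈ I := by
    have : r = y - q * (D.i a⁻¹ * x) := by rw [hq]; abel
    rw [this]
    exact I.sub_mem hy (I.mul_mem_left _ hzI)
  have hr' : D.deg r < Nat.find hex := (hz.deg_eq one_ne_zero) ▸ hr
  exact ⟨q, by rw [hq, hmin r hrI hr', add_zero]⟩

lemma mem_center_of_commute {z : R} (hi : ∀ a, D.i a * z = z * D.i a)
    (ht : D.t * z = z * D.t) : z ∈ Subring.center R := by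
  rw [Subring.mem_center_iff]
  intro x
  induction x using D.induction_on with
  | zero => simp
  | add x y hx hy => rw [add_mul, mul_add, hx, hy]
  | monomial a n =>
    exact (Commute.mul_left (hi a) (Commute.pow_left ht n)).eq

lemma i_algebraMap_mem_center {F : Type} [Field F] [Algebra F K] (hconst : δ.HasConstants F)
    (c : F) : D.i (algebraMap F K c) ∈ Subring.center R :=
  D.mem_center_of_commute (fun a => by rw [← map_mul, ← map_mul, mul_comm])
    (by rw [D.t_mul, (hconst _).2 ⟨c, rfl⟩, map_zero, add_zero])

lemma exists_central_generator {I : Ideal R} (hI : I ≠ ⊥)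
    (hmul : ∀ x ∈ I, ∀ r, x * r ∈ I) :
    ∃ (z : R) (n : ℕ), z ∈ I ∧ z ∈ Subring.center R ∧ z ≠ 0 ∧ D.HasTop z n 1 ∧
      ∀ x ∈ I, ∃ q, x = q * z := by
  obtain ⟨z, n, hzI, hz0, hz, hmin, hgen⟩ := D.exists_monic_generator hI
  refine ⟨z, n, hzI, D.mem_center_of_commute (fun a => ?_) ?_, hz0, hz, hgen⟩
  · refine sub_eq_zero.1 (hmin _ (I.sub_mem (I.mul_mem_left _ hzI) (hmul _ hzI _)) ?_)
    have h1 := (D.hasTop_i a).mul hz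
    have h2 := hz.mul (D.hasTop_i a)
    rw [zero_add] at h1
    have h := h1.sub h2
    rw [mul_comm, sub_self] at h
    exact h.deg_lt
  · refine sub_eq_zero.1 (hmin _ (I.sub_mem (I.mul_mem_left _ hzI) (hmul _ hzI _)) ?_)
    rw [D.deg_lt_iff]
    intro j hj
    rw [D.coeff_commutator_t]
    rcases hj.eq_or_lt with rfl | hj
    · rw [hz.1, δ.map_one]
    · rw [hz.2 j hj, δ.map_zero]

end Ideals

section Remainder

variable (D : DiffPolyRing K δ R) {f : R}

lemma modr_spec (hf : f ≠ 0) (x : R) :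
    (∃ q, x = q * f + D.modr f x) ∧ D.deg (D.modr f x) < D.deg f := by
  rw [modr, dif_pos (D.rightDiv f x hf)]
  exact (D.rightDiv f x hf).choose_spec.1

lemma eq_modr (hf : f ≠ 0) {x q r : R} (h : x = q * f + r) (hr : D.deg r < D.deg f) :
    r = D.modr f x :=
  (D.rightDiv f x hf).unique ⟨⟨q, h⟩, hr⟩ (D.modr_spec hf x)

lemma modr_add (hf : f ≠ 0) (x y : R) : D.modr f (x + y) = D.modr f x + D.modr f y := by
  obtain ⟨⟨q, hq⟩, hx⟩ := D.modr_spec hf x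
  obtain ⟨⟨p, hp⟩, hy⟩ := D.modr_spec hf y
  refine (D.eq_modr hf (q := q + p) ?_ (D.deg_add_lt hx hy)).symm
  conv_lhs => rw [hq, hp]
  rw [add_mul]
  abel

lemma modr_i_mul (hf : f ≠ 0) (c : K) (x : R) : D.modr f (D.i c * x) = D.i c * D.modr f x := by
  obtain ⟨⟨q, hq⟩, hx⟩ := D.modr_spec hf x
  refine (D.eq_modr hf (q := D.i c * q) ?_ (D.deg_i_mul_lt c hx)).symm
  conv_lhs => rw [hq]
  rw [mul_add, mul_assoc]

lemma modr_eq_zero_iff (hf : f ≠ 0) {x : R} : D.modr f x = 0 ↔ ∃ q, x = q * f := by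
  constructor
  · intro h
    obtain ⟨⟨q, hq⟩, -⟩ := D.modr_spec hf x
    exact ⟨q, by rw [hq, h, add_zero]⟩
  · rintro ⟨q, hq⟩
    refine (D.eq_modr hf (q := q) (by rw [hq, add_zero]) ?_).symm
    obtain ⟨n, a, ha, hn⟩ := D.exists_hasTop hf
    rw [D.deg_zero, hn.deg_eq ha]
    exact WithBot.bot_lt_coe n

end Remainder

section FiniteExtension

variable {F : Type} [Field F] [Algebra F K] (D : DiffPolyRing K δ R)

lemma finiteDimensional_Rlt [FiniteDimensional F K] (m : ℕ) : FiniteDimensional F (D.Rlt m) := by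
  let φ : D.Rlt m →ₗ[F] (Fin m → K) :=
    { toFun := fun x j => D.coeff x j
      map_add' := fun x y => by
        funext j
        simp [D.coeff_add]
      map_smul' := fun c x => by
        funext j
        simp [D.smul_coe, D.coeff_smul, Algebra.smul_def] }
  refine FiniteDimensional.of_injective φ fun x y h => Subtype.ext (D.coeff_injective ?_)
  ext j
  by_cases hj : j < m
  · exact congrFun h ⟨j, hj⟩
  · rw [D.deg_lt_iff.1 x.2 j (not_lt.1 hj), D.deg_lt_iff.1 y.2 j (not_lt.1 hj)]

/-- The restriction of scalars of `K[t;δ]` to the field of constants. -/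
abbrev constModule (F : Type) [Field F] [Algebra F K] (D : DiffPolyRing K δ R) : Module F R :=
  Module.compHom R (D.i.comp (algebraMap F K))

lemma not_finite_constModule : ¬ @Module.Finite F R _ _ (D.constModule F) := by
  let := D.constModule F
  intro hfin
  let φ : R →ₗ[F] (ℕ →₀ K) :=
    { toFun := D.coeff
      map_add' := D.coeff_add
      map_smul' := fun c x => by
        change D.coeff (D.i (algebraMap F K c) * x) = _
        rw [D.coeff_smul]
        ext j
        simp [Algebra.smul_def] }
  have hφ : Function.Surjective φ := fun c => ⟨_, (D.coeff_unique _ c rfl).symm⟩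
  have hK : Module.Finite F (ℕ →₀ K) := Module.Finite.of_surjective φ hφ
  have hli : LinearIndependent F fun n : ℕ => (Finsupp.single n (1 : K)) := by
    have h := (Finsupp.basisSingleOne (R := K) (ι := ℕ)).linearIndependent
    have h' := h.restrict_scalars (R := F) (by
      intro a b hab
      exact (algebraMap F K).injective (by simpa [Algebra.smul_def] using hab))
    simpa using h'
  have := hli.finite
  exact not_finite ℕ

/-- Left multiplication on `K[t;δ]` modulo `K[t;δ]f`, on representatives of degree `< m`. -/
noncomputable def mulModr (hconst : δ.HasConstants F) {f : R} {m : ℕ} (hf : f ≠ 0)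
    (hm : D.deg f = m) (x : R) : D.Rlt m →ₗ[F] D.Rlt m where
  toFun r := ⟨D.modr f (x * r), (D.modr_spec hf _).2.trans_eq hm⟩
  map_add' r s := Subtype.ext <| by simp [mul_add, D.modr_add hf]
  map_smul' c r := Subtype.ext <| by
    have hc := (Subring.mem_center_iff.1 (D.i_algebraMap_mem_center hconst c)) x
    simp only [D.smul_coe, RingHom.id_apply]
    rw [← D.modr_i_mul hf, ← mul_assoc, hc, mul_assoc]

/-- The annihilator of `K[t;δ]/K[t;δ]f`. -/
def annihilator (f : R) : Ideal R where
  carrier := {x | ∀ r, ∃ q, x * r = q * f}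
  zero_mem' r := ⟨0, by simp⟩
  add_mem' {x y} hx hy r := by
    obtain ⟨q, hq⟩ := hx r
    obtain ⟨p, hp⟩ := hy r
    exact ⟨q + p, by rw [add_mul, add_mul, hq, hp]⟩
  smul_mem' c x hx r := by
    obtain ⟨q, hq⟩ := hx r
    exact ⟨c * q, by rw [smul_eq_mul, mul_assoc, hq, mul_assoc]⟩

lemma annihilator_ne_bot (D : DiffPolyRing K δ R) [FiniteDimensional F K] (hconst : δ.HasConstants F) {f : R}
    (hf : f ≠ 0) : annihilator f ≠ ⊥ := by
  intro hbot
  obtain ⟨m, a, ha, hm⟩ := D.exists_hasTop hf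
  have hdeg := hm.deg_eq ha
  let := D.constModule F
  have := D.finiteDimensional_Rlt (F := F) m
  let φ : R →ₗ[F] Module.End F (D.Rlt m) :=
    { toFun := D.mulModr hconst hf hdeg
      map_add' := fun x y => LinearMap.ext fun r => Subtype.ext <| by
        simp [mulModr, add_mul, D.modr_add hf]
      map_smul' := fun c x => LinearMap.ext fun r => Subtype.ext <| by
        change D.modr f (D.i (algebraMap F K c) * x * r) = D.i (algebraMap F K c) * _
        rw [mul_assoc, D.modr_i_mul hf]
        rfl }
  refine D.not_finite_constModule (F := F) (FiniteDimensional.of_injective φ ?_)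
  rw [injective_iff_map_eq_zero]
  intro x hx
  rw [← Submodule.mem_bot (R := R), ← hbot]
  intro r
  obtain ⟨⟨q, hq⟩, hr⟩ := D.modr_spec hf r
  have h0 : D.modr f (x * D.modr f r) = 0 :=
    congrArg Subtype.val (LinearMap.congr_fun hx ⟨D.modr f r, hr.trans_eq hdeg⟩)
  obtain ⟨p, hp⟩ := (D.modr_eq_zero_iff hf).1 h0
  exact ⟨x * q + p, by rw [add_mul, ← hp, mul_assoc, ← mul_add, ← hq]⟩

lemma exists_central_generator_annihilator [FiniteDimensional F K] (hconst : δ.HasConstants F)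
    {f : R} (hf : f ≠ 0) :
    ∃ (z : R) (n : ℕ), z ∈ annihilator f ∧ z ∈ Subring.center R ∧ z ≠ 0 ∧ D.HasTop z n 1 ∧
      ∀ x ∈ annihilator f, ∃ q, x = q * z :=
  D.exists_central_generator (D.annihilator_ne_bot hconst hf) fun x hx r s => by
    rw [mul_assoc]
    exact hx (r * s)

theorem isBounded [FiniteDimensional F K] (hconst : δ.HasConstants F) {f : R} (hf : f ≠ 0) :
    D.IsBounded f := by
  obtain ⟨z, n, hz, hzc, hz0, -, hgen⟩ := D.exists_central_generator_annihilator hconst hf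
  rw [Subring.mem_center_iff] at hzc
  refine ⟨z, hz0, by simp only [hzc], ?_, fun J _ _ hmul hJ x hx => hgen x fun r => ?_⟩
  · rintro _ ⟨r, rfl⟩
    obtain ⟨q, hq⟩ := hz 1
    exact ⟨r * q, by rw [mul_assoc, ← hq, mul_one]⟩
  · exact hJ _ (hmul r x hx).2

theorem finite_center (D : DiffPolyRing K δ R) [FiniteDimensional F K] (hconst : δ.HasConstants F) :
    Module.Finite (Subring.center R) R := by
  have ht : D.HasTop D.t 1 1 := by
    have h := D.coeff_monomial 1 1
    rw [map_one, one_mul, pow_one] at h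
    rw [HasTop, h]
    exact ⟨by simp, fun j hj => Finsupp.single_eq_of_ne hj.ne'⟩
  have ht0 : D.t ≠ 0 := by
    intro h
    have := ht.1
    simp [h, D.coeff_zero] at this
  obtain ⟨z, d, hz, hzc, hz0, hzd, -⟩ := D.exists_central_generator_annihilator hconst ht0
  have hd : 0 < d := by
    obtain ⟨q, hq⟩ := hz 1
    rw [mul_one] at hq
    have hq0 : q ≠ 0 := by
      rintro rfl
      exact hz0 (by rw [hq, zero_mul])
    obtain ⟨k, b, hb, hk⟩ := D.exists_hasTop hq0
    have h := (hk.mul ht).deg_eq (mul_ne_zero hb one_ne_zero)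
    rw [← hq, hzd.deg_eq one_ne_zero] at h
    have hdk : d = k + 1 := WithBot.coe_injective h
    omega
  let b := Module.finBasis F K
  let g : Fin (Module.finrank F K) × Fin d → R := fun p => D.i (b p.1) * D.t ^ (p.2 : ℕ)
  refine ⟨Submodule.fg_iff_exists_finite_generating_family.2 ⟨_, inferInstance, g, ?_⟩⟩
  have hmono : ∀ (a : K) (j : ℕ), j < d →
      D.i a * D.t ^ j ∈ Submodule.span (Subring.center R) (Set.range g) := by
    intro a j hj
    rw [← b.sum_repr a, map_sum, Finset.sum_mul]
    refine Submodule.sum_mem _ fun k _ => ?_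
    rw [Algebra.smul_def, map_mul, mul_assoc]
    exact Submodule.smul_mem _ (⟨_, D.i_algebraMap_mem_center hconst _⟩ : Subring.center R)
      (Submodule.subset_span ⟨(k, ⟨j, hj⟩), rfl⟩)
  have hlow : ∀ x, D.deg x < d → x ∈ Submodule.span (Subring.center R) (Set.range g) := by
    intro x hx
    rw [D.repr' x]
    refine Submodule.sum_mem _ fun j hj => hmono _ _ (lt_of_not_ge fun hjd => ?_)
    simp [D.deg_lt_iff.1 hx j hjd] at hj
  have hall : ∀ (N : ℕ) (x : R), D.deg x < N →
      x ∈ Submodule.span (Subring.center R) (Set.range g) := by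
    intro N
    induction N with
    | zero => exact fun x hx => hlow x (hx.trans_le (WithBot.coe_le_coe.2 d.zero_le))
    | succ N ih =>
      intro x hx
      obtain ⟨⟨q, hq⟩, hr⟩ := D.modr_spec hz0 x
      rw [hzd.deg_eq one_ne_zero] at hr
      rw [hq, Subring.mem_center_iff.1 hzc q]
      refine Submodule.add_mem _ (Submodule.smul_mem _ (⟨z, hzc⟩ : Subring.center R) ?_)
        (hlow _ hr)
      by_cases hq0 : q = 0
      · simp [hq0]
      obtain ⟨k, c, hc, hk⟩ := D.exists_hasTop hq0
      refine ih q ?_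
      have htop := hk.mul hzd
      rw [hk.deg_eq hc]
      by_contra hNk
      have hNk' : N ≤ k := WithBot.coe_le_coe.1 (not_lt.1 hNk)
      have hx' := D.deg_lt_iff.1 hx (k + d) (by omega)
      rw [hq, D.coeff_add, Finsupp.add_apply, htop.1, D.deg_lt_iff.1 hr _ (by omega), add_zero,
        mul_one] at hx'
      exact hc hx'
  refine eq_top_iff.2 fun x _ => ?_
  by_cases hx : x = 0
  · simp [hx]
  obtain ⟨k, c, hc, hk⟩ := D.exists_hasTop hx
  exact hall _ x hk.deg_lt_succ

theorem finiteDimensional_of_finite_center (D : DiffPolyRing K δ R) (hconst : δ.HasConstants F)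
    [Module.Finite (Subring.center R) R] : FiniteDimensional F K := by
  let b := Module.Basis.ofVectorSpace F K
  have := D.nontrivial
  have hli : LinearIndependent (Subring.center R) fun k => D.i (b k) := by
    rw [linearIndependent_iff']
    intro s g hg k hk
    have hcoeff : ∀ (x : Subring.center R) (n : ℕ), ∃ c : F, algebraMap F K c = D.coeff x n := by
      intro x n
      rw [← hconst, ← D.coeff_commutator_t, Subring.mem_center_iff.1 x.2, sub_self, D.coeff_zero,
        Finsupp.zero_apply]
    choose c hc using hcoeff
    refine Subtype.ext (D.coeff_injective (Finsupp.ext fun n => ?_))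
    have hsum : ∑ j ∈ s, c (g j) n • b j = 0 := by
      have h := congrArg (fun x => D.coeff x n) hg
      simp only [D.coeff_sum, D.coeff_zero, Finsupp.finsetSum_apply, Finsupp.zero_apply] at h
      rw [← h]
      refine Finset.sum_congr rfl fun j _ => ?_
      rw [Subring.smul_def, smul_eq_mul, ← Subring.mem_center_iff.1 (g j).2, D.coeff_smul,
        Finsupp.smul_apply, ← hc, Algebra.smul_def, smul_eq_mul, mul_comm]
    rw [← hc, linearIndependent_iff'.1 b.linearIndependent s _ hsum k hk]
    simp [D.coeff_zero]
  have := hli.finite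
  exact Module.Finite.of_basis b

end FiniteExtension

section Division

variable (D : DiffPolyRing K δ R) {f : R} {m : ℕ}

lemma exists_bezout (hdeg : D.deg f = m) (hirr : D.Irred f) {a : R} (ha : a ≠ 0)
    (ham : D.deg a < m) (s : R) : ∃ y h, s = y * a + h * f := by
  have hf : f ≠ 0 := by
    rintro rfl
    rw [D.deg_zero] at hdeg
    exact WithBot.bot_ne_coe hdeg
  let I : Ideal R := Ideal.span {a, f}
  have haI : a ∈ I := Ideal.subset_span (by simp)
  have hfI : f ∈ I := Ideal.subset_span (by simp)
  have hI : I ≠ ⊥ := fun h => ha (by rw [h] at haI; simpa using haI)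
  obtain ⟨z, n, hzI, hz0, hz, -, hgen⟩ := D.exists_monic_generator hI
  obtain ⟨q, hq⟩ := hgen f hfI
  obtain ⟨p, hp⟩ := hgen a haI
  have hp0 : p ≠ 0 := by
    rintro rfl
    exact ha (by rw [hp, zero_mul])
  have hzf : D.deg z < D.deg f := by
    rw [hdeg]
    refine lt_of_le_of_lt (not_lt.1 fun h => hp0 ?_) ham
    exact D.eq_zero_of_mul_deg_lt hz0 (hp ▸ h)
  have hq0 : q ≠ 0 := by
    rintro rfl
    exact hf (by rw [hq, zero_mul])
  obtain ⟨k, b, hb, hk⟩ := D.exists_hasTop hq0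
  have hn : n = 0 := by
    by_contra hn
    refine hirr.2 ⟨q, z, hq, ?_, hzf⟩
    conv_rhs => rw [hq]
    rw [(hk.mul hz).deg_eq (mul_ne_zero hb one_ne_zero), hk.deg_eq hb]
    exact WithBot.coe_lt_coe.2 (Nat.lt_add_of_pos_right (Nat.pos_of_ne_zero hn))
  subst hn
  have hz1 : z = 1 := by
    refine D.coeff_injective (Finsupp.ext fun j => ?_)
    rw [← map_one D.i, D.coeff_i]
    rcases Nat.eq_zero_or_pos j with rfl | hj
    · simp [hz.1]
    · rw [hz.2 j hj, Finsupp.single_eq_of_ne hj.ne']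
  have hs : s ∈ I := by
    rw [← mul_one s]
    exact I.mul_mem_left s (hz1 ▸ hzI)
  obtain ⟨y, h, hyh⟩ := Ideal.mem_span_pair.1 hs
  exact ⟨y, h, hyh.symm⟩

variable {F : Type} [Field F] [Algebra F K]

/-- Right multiplication by `a` modulo `K[t;δ]f`, on polynomials of degree `< m`. -/
noncomputable def modrMul (F : Type) [Field F] [Algebra F K] (hf : f ≠ 0) (hm : D.deg f = m)
    (a : R) : D.Rlt m →ₗ[F] D.Rlt m where
  toFun r := ⟨D.modr f (r * a), (D.modr_spec hf _).2.trans_eq hm⟩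
  map_add' r s := Subtype.ext <| by simp [add_mul, D.modr_add hf]
  map_smul' c r := Subtype.ext <| by
    simp only [D.smul_coe, RingHom.id_apply]
    rw [mul_assoc, D.modr_i_mul hf]

lemma modr_mul_ne_zero (F : Type) [Field F] [Algebra F K] [FiniteDimensional F K]
    (hf : f ≠ 0) (hdeg : D.deg f = m) (hirr : D.Irred f) {x a : R}
    (hx : x ≠ 0) (hxm : D.deg x < m) (ha : a ≠ 0) (ham : D.deg a < m) :
    D.modr f (x * a) ≠ 0 := by
  intro h0
  have := D.finiteDimensional_Rlt (F := F) m
  obtain ⟨p, hp⟩ := (D.modr_eq_zero_iff hf).1 h0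
  have hsurj : Function.Surjective (D.modrMul F hf hdeg a) := by
    intro s
    obtain ⟨y, h, hs⟩ := D.exists_bezout hdeg hirr ha ham s
    obtain ⟨⟨q, hq⟩, hr⟩ := D.modr_spec hx y
    refine ⟨⟨D.modr x y, hr.trans hxm⟩, Subtype.ext ?_⟩
    refine (D.eq_modr hf (q := -(q * p + h)) ?_ (s.2.trans_eq hdeg.symm)).symm
    have hr : D.modr x y = y - q * x := eq_sub_of_add_eq' hq.symm
    change D.modr x y * a = _
    rw [hs, hr, sub_mul, mul_assoc, hp]
    noncomm_ring
  have hinj := LinearMap.injective_iff_surjective.2 hsurj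
  exact hx (congrArg Subtype.val
    (hinj (a₁ := ⟨x, hxm⟩) (a₂ := 0) (by rw [map_zero]; exact Subtype.ext h0)))

lemma bijOn_of_injective {m : ℕ} [FiniteDimensional F K] (φ : D.Rlt m →ₗ[F] D.Rlt m)
    {g : R → R} (hg : ∀ x : D.Rlt m, (φ x : R) = g x)
    (hker : ∀ x ∈ D.SfSet m, x ≠ 0 → g x ≠ 0) :
    Set.BijOn g (D.SfSet m) (D.SfSet m) := by
  have := D.finiteDimensional_Rlt (F := F) m
  have hinj : Function.Injective φ := by
    rw [injective_iff_map_eq_zero]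
    intro x hx
    by_contra hx0
    refine hker x x.2 (fun h => hx0 (Subtype.ext h)) ?_
    rw [← hg, hx]
    rfl
  refine ⟨fun x hx => ?_, fun x hx y hy hxy => ?_, fun y hy => ?_⟩
  · have h := (φ ⟨x, hx⟩).2
    rwa [hg] at h
  · have h : φ ⟨x, hx⟩ = φ ⟨y, hy⟩ := Subtype.ext (by rw [hg, hg]; exact hxy)
    exact congrArg Subtype.val (hinj h)
  · obtain ⟨x, hx⟩ := LinearMap.injective_iff_surjective.1 hinj ⟨y, hy⟩
    exact ⟨x, x.2, by rw [← hg, hx]⟩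

theorem isDivisionPetit [FiniteDimensional F K] (hconst : δ.HasConstants F) (hm : 0 < m)
    (hdeg : D.deg f = m) (hirr : D.Irred f) : D.IsDivisionPetit f m := by
  obtain ⟨c, hc, htop⟩ := D.hasTop_of_deg_eq hdeg
  have hf : f ≠ 0 := by
    rintro rfl
    exact hc (by rw [← htop.1, D.coeff_zero, Finsupp.zero_apply])
  have := D.nontrivial
  refine ⟨⟨1, ?_, one_ne_zero⟩, fun a ham ha => ⟨?_, ?_⟩⟩
  · change D.deg 1 < m
    rw [← map_one D.i, (D.hasTop_i 1).deg_eq one_ne_zero]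
    exact WithBot.coe_lt_coe.2 hm
  · exact D.bijOn_of_injective (D.mulModr hconst hf hdeg a) (fun _ => rfl) fun x hxm hx =>
      D.modr_mul_ne_zero F hf hdeg hirr ha ham hx hxm
  · exact D.bijOn_of_injective (D.modrMul F hf hdeg a) (fun _ => rfl) fun x hxm hx =>
      D.modr_mul_ne_zero F hf hdeg hirr hx hxm ha ham

end Division

end DiffPolyRing

/-- For a nonzero derivation `δ` on `K` with field of constants `F`, the
ring `R = K[t;δ]` has finite rank over its center if and only if `K/F` is a finite field
extension; and if `K/F` is finite then every nonzero `f ∈ R` is bounded, and every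
irreducible `f ∈ R` of degree `m ≥ 2` yields a Petit algebra `S_f` which is a division
algebra. -/
theorem statement_14 (F K : Type) [Field F] [Field K] [Algebra F K]
    (δ : Der K) (hδ : ∃ a : K, δ.toFun a ≠ 0) (hconst : δ.HasConstants F)
    (R : Type) [Ring R] (D : DiffPolyRing K δ R) :
    ((∃ (n : ℕ) (b : Fin n → R), ∀ x : R, ∃ c : Fin n → R,
        (∀ j, c j ∈ Subring.center R) ∧ x = ∑ j, c j * b j) ↔ FiniteDimensional F K) ∧
    (FiniteDimensional F K →
      (∀ f : R, f ≠ 0 → D.IsBounded f) ∧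
      ∀ (f : R) (m : ℕ), 2 ≤ m → D.deg f = (m : WithBot ℕ) → D.Irred f →
        D.IsDivisionPetit f m) := by
  refine ⟨⟨?_, ?_⟩, fun _ => ⟨fun f hf => D.isBounded hconst hf, fun f m hm hdeg hirr =>
    D.isDivisionPetit hconst (by omega) hdeg hirr⟩⟩
  · rintro ⟨n, b, hb⟩
    have : Module.Finite (Subring.center R) R := by
      refine ⟨Submodule.fg_iff_exists_fin_generating_family.2 ⟨n, b, eq_top_iff.2 fun x _ => ?_⟩⟩
      obtain ⟨c, hc, rfl⟩ := hb x
      exact Submodule.sum_mem _ fun j _ => Submodule.smul_mem _ (⟨c j, hc j⟩ : Subring.center R)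
        (Submodule.subset_span ⟨j, rfl⟩)
    exact D.finiteDimensional_of_finite_center hconst
  · intro _
    have := D.finite_center hconst
    obtain ⟨n, b, hb⟩ := Module.Finite.exists_fin (R := Subring.center R) (M := R)
    refine ⟨n, b, fun x => ?_⟩
    obtain ⟨c, hc⟩ := (Submodule.mem_span_range_iff_exists_fun _).1
      (hb ▸ Submodule.mem_top : x ∈ Submodule.span (Subring.center R) (Set.range b))
    exact ⟨fun j => c j, fun j => (c j).2, hc.symm⟩
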